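/- Let X₁,...,X_N be mutually independent Bernoulli random variables with probabilities p_i = P(X_i = 1) satisfying ℓ_i ≤ p_i ≤ u_i for given bounds 0 ≤ ℓ_i ≤ u_i ≤ 1. Consider the bivariate polynomial F(x,y) = ∏_{i=1}^N (ℓ_i·x + (1−u_i)·y? correction: (ℓ_i·x + (u_i−ℓ_i)·y + (1−u_i))) = Σ_{i,j} c_{i,j} x^i y^j. Then for every k: c_{k,0} ≤ P(Σ_i X_i = k) ≤ Σ_{i≤k, i+j≥k} c_{i,j}. -/

import Mathlib

open MvPolynomial

/-- The uncertain generating function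
`F(x,y) = ∏ i, (ℓᵢ·x + (uᵢ−ℓᵢ)·y + (1−uᵢ))`, with `x = X 0`, `y = X 1`. -/
noncomputable def UGF (N : ℕ) (l u : Fin N → ℝ) : MvPolynomial (Fin 2) ℝ :=
  ∏ i, (C (l i) * X 0 + C (u i - l i) * X 1 + C (1 - u i))

/-- The coefficient `c_{i,j}` of `x^i y^j` in the uncertain generating function. -/
noncomputable def ugfCoeff (N : ℕ) (l u : Fin N → ℝ) (i j : ℕ) : ℝ :=
  MvPolynomial.coeff (Finsupp.single 0 i + Finsupp.single 1 j) (UGF N l u)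

/-- `P(X₁ + ... + X_N = k)` for independent Bernoulli variables with success
probabilities `p i` (joint law = product measure on `Fin N → Bool`). -/
noncomputable def bernoulliSumProb (N : ℕ) (p : Fin N → ℝ) (k : ℕ) : ℝ :=
  ∑ ω : Fin N → Bool, (∏ i, if ω i then p i else 1 - p i) *
    (if (Finset.univ.filter fun i => ω i = true).card = k then 1 else 0)

/-- The three outcomes of one uncertain trial: certain success (`0`, weight `l`), undetermined
(`1`, weight `u - l`) and certain failure (`2`, weight `1 - u`). -/
noncomputable def trialWeight (l u : ℝ) : Fin 3 → ℝ := ![l, u - l, 1 - u]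

/-- Coupling of an uncertain trial with bounds `l, u` and a Bernoulli trial of parameter `p`. -/
noncomputable def trialCoupling (l u p : ℝ) (a : Fin 3) (b : Bool) : ℝ :=
  if b then ![l, p - l, 0] a else ![0, u - p, 1 - u] a

/-- The exponent of the monomial that records the outcome of an uncertain trial. -/
noncomputable def trialExponent : Fin 3 → (Fin 2 →₀ ℕ) :=
  ![Finsupp.single 0 1, Finsupp.single 1 1, 0]

/-- The number of trials in `f` with outcome `a`. -/
def outcomeCount {ι α : Type*} [Fintype ι] [DecidableEq α] (f : ι → α) (a : α) : ℕ :=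
  (Finset.univ.filter fun i => f i = a).card

theorem sum_trialCoupling_bool (l u p : ℝ) (a : Fin 3) :
    ∑ b, trialCoupling l u p a b = trialWeight l u a := by
  fin_cases a <;> simp [trialCoupling, trialWeight]

theorem sum_trialCoupling_outcome (l u p : ℝ) (b : Bool) :
    ∑ a, trialCoupling l u p a b = if b then p else 1 - p := by
  cases b <;> simp [trialCoupling, Fin.sum_univ_three]

theorem trialCoupling_nonneg {l u p : ℝ} (h : 0 ≤ l ∧ l ≤ p ∧ p ≤ u ∧ u ≤ 1) (a : Fin 3)
    (b : Bool) : 0 ≤ trialCoupling l u p a b := by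
  obtain ⟨h₁, h₂, h₃, h₄⟩ := h
  fin_cases a <;> cases b <;> simp [trialCoupling] <;> assumption

theorem prod_monomial_eq_monomial_sum {ι σ R : Type*} [CommSemiring R] (s : Finset ι)
    (e : ι → σ →₀ ℕ) (c : ι → R) :
    ∏ i ∈ s, monomial (e i) (c i) = monomial (∑ i ∈ s, e i) (∏ i ∈ s, c i) := by
  classical
  induction s using Finset.induction_on with
  | empty => simp
  | insert a s ha ih => simp [Finset.prod_insert ha, Finset.sum_insert ha, ih, monomial_mul]

theorem sum_trialExponent {N : ℕ} (f : Fin N → Fin 3) :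
    ∑ i, trialExponent (f i) =
      Finsupp.single 0 (outcomeCount f 0) + Finsupp.single 1 (outcomeCount f 1) := by
  have h₀ (a : Fin 3) : trialExponent a 0 = if a = 0 then 1 else 0 := by
    fin_cases a <;> simp [trialExponent]
  have h₁ (a : Fin 3) : trialExponent a 1 = if a = 1 then 1 else 0 := by
    fin_cases a <;> simp [trialExponent]
  ext j
  fin_cases j <;> simp [Finsupp.finsetSum_apply, h₀, h₁, outcomeCount]

theorem single_add_single_eq_iff (a b i j : ℕ) :
    (Finsupp.single 0 a + Finsupp.single 1 b : Fin 2 →₀ ℕ) =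
      Finsupp.single 0 i + Finsupp.single 1 j ↔ a = i ∧ b = j := by
  simp [Finsupp.ext_iff]

theorem ugfCoeff_eq_sum (N : ℕ) (l u : Fin N → ℝ) (i j : ℕ) :
    ugfCoeff N l u i j = ∑ f : Fin N → Fin 3, (∏ n, trialWeight (l n) (u n) (f n)) *
      if outcomeCount f 0 = i ∧ outcomeCount f 1 = j then 1 else 0 := by
  have hfac (n : Fin N) : C (l n) * X 0 + C (u n - l n) * X 1 + C (1 - u n) =
      ∑ a, monomial (trialExponent a) (trialWeight (l n) (u n) a) := by
    simp only [Fin.sum_univ_three, trialExponent, trialWeight, C_mul_X_eq_monomial]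
    rfl
  unfold ugfCoeff UGF
  simp only [hfac, Finset.prod_univ_sum, Fintype.piFinset_univ, prod_monomial_eq_monomial_sum,
    coeff_sum, coeff_monomial, sum_trialExponent, single_add_single_eq_iff, mul_ite, mul_one,
    mul_zero]

theorem sum_prod_trialWeight_mul {N : ℕ} (l u p : Fin N → ℝ) (g : (Fin N → Fin 3) → ℝ) :
    ∑ f, (∏ n, trialWeight (l n) (u n) (f n)) * g f =
      ∑ f, ∑ ω : Fin N → Bool, (∏ n, trialCoupling (l n) (u n) (p n) (f n) (ω n)) * g f := by
  have hw (n : Fin N) (a : Fin 3) := (sum_trialCoupling_bool (l n) (u n) (p n) a).symm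
  simp only [hw, Finset.prod_univ_sum, Fintype.piFinset_univ, Finset.sum_mul]

theorem bernoulliSumProb_eq_sum (N : ℕ) (l u p : Fin N → ℝ) (k : ℕ) :
    bernoulliSumProb N p k = ∑ f : Fin N → Fin 3, ∑ ω : Fin N → Bool,
      (∏ n, trialCoupling (l n) (u n) (p n) (f n) (ω n)) *
        if outcomeCount ω true = k then 1 else 0 := by
  have hb (n : Fin N) (b : Bool) := (sum_trialCoupling_outcome (l n) (u n) (p n) b).symm
  rw [Finset.sum_comm]
  simp only [bernoulliSumProb, outcomeCount, hb, Finset.prod_univ_sum, Fintype.piFinset_univ,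
    Finset.sum_mul]
  congr!

theorem outcomeCount_bounds_of_prod_ne_zero {N : ℕ} {l u p : Fin N → ℝ} {f : Fin N → Fin 3}
    {ω : Fin N → Bool} (h : ∏ n, trialCoupling (l n) (u n) (p n) (f n) (ω n) ≠ 0) :
    outcomeCount f 0 ≤ outcomeCount ω true ∧
      outcomeCount ω true ≤ outcomeCount f 0 + outcomeCount f 1 := by
  have hn (n : Fin N) := Finset.prod_ne_zero_iff.1 h n (Finset.mem_univ n)
  have h₀ (n : Fin N) (hf : f n = 0) : ω n = true := by
    by_contra hω
    exact hn n (by simp [trialCoupling, hf, hω])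
  have h₂ (n : Fin N) (hω : ω n = true) : f n = 0 ∨ f n = 1 := by
    have hne : f n ≠ 2 := fun hf => hn n (by simp [trialCoupling, hf, hω])
    generalize f n = a at hne ⊢
    fin_cases a <;> simp_all
  refine ⟨Finset.card_le_card fun n => by simpa using h₀ n,
    (Finset.card_le_card fun n => ?_).trans (Finset.card_union_le _ _)⟩
  simpa using h₂ n

theorem sum_ugfCoeff_eq_sum (N : ℕ) (l u : Fin N → ℝ) (k : ℕ) :
    (∑ i ∈ Finset.range (k + 1), ∑ j ∈ Finset.range (N + 1),
        if k ≤ i + j then ugfCoeff N l u i j else 0) =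
      ∑ f : Fin N → Fin 3, (∏ n, trialWeight (l n) (u n) (f n)) *
        if outcomeCount f 0 ≤ k ∧ k ≤ outcomeCount f 0 + outcomeCount f 1 then 1 else 0 := by
  rw [← Finset.sum_product', ← Finset.sum_filter]
  simp only [ugfCoeff_eq_sum]
  rw [Finset.sum_comm]
  refine Finset.sum_congr rfl fun f _ => ?_
  have hN : outcomeCount f 1 ≤ N := (Finset.card_le_univ _).trans_eq (Fintype.card_fin N)
  have heq (x : ℕ × ℕ) : (outcomeCount f 0 = x.1 ∧ outcomeCount f 1 = x.2) ↔
      (outcomeCount f 0, outcomeCount f 1) = x := by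
    simp [Prod.ext_iff]
  simp only [← Finset.mul_sum, heq, Finset.sum_ite_eq, Finset.mem_filter, Finset.mem_product,
    Finset.mem_range, Nat.lt_succ_iff, hN, and_true]

/-- For any independent Bernoulli variables whose success probabilities `pᵢ` lie
in `[ℓᵢ, uᵢ]`, the UGF coefficients bound `P(Σᵢ Xᵢ = k)`:
`c_{k,0} ≤ P(Σ Xᵢ = k) ≤ Σ_{i≤k, i+j≥k} c_{i,j}`. -/
theorem stmt9 (N : ℕ) (l u p : Fin N → ℝ)
    (h : ∀ i, 0 ≤ l i ∧ l i ≤ p i ∧ p i ≤ u i ∧ u i ≤ 1) (k : ℕ) :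
    ugfCoeff N l u k 0 ≤ bernoulliSumProb N p k ∧
    bernoulliSumProb N p k ≤
      ∑ i ∈ Finset.range (k + 1), ∑ j ∈ Finset.range (N + 1),
        if k ≤ i + j then ugfCoeff N l u i j else 0 := by
  have hmono (A B : (Fin N → Fin 3) → (Fin N → Bool) → Prop) [∀ f ω, Decidable (A f ω)]
      [∀ f ω, Decidable (B f ω)]
      (hAB : ∀ f ω, outcomeCount f 0 ≤ outcomeCount ω true →
        outcomeCount ω true ≤ outcomeCount f 0 + outcomeCount f 1 → A f ω → B f ω) :
      (∑ f, ∑ ω, (∏ n, trialCoupling (l n) (u n) (p n) (f n) (ω n)) *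
        if A f ω then (1 : ℝ) else 0) ≤
      ∑ f, ∑ ω, (∏ n, trialCoupling (l n) (u n) (p n) (f n) (ω n)) *
        if B f ω then (1 : ℝ) else 0 := by
    refine Finset.sum_le_sum fun f _ => Finset.sum_le_sum fun ω _ => ?_
    by_cases h₀ : ∏ n, trialCoupling (l n) (u n) (p n) (f n) (ω n) = 0
    · simp [h₀]
    obtain ⟨h₁, h₂⟩ := outcomeCount_bounds_of_prod_ne_zero h₀
    refine mul_le_mul_of_nonneg_left ?_
      (Finset.prod_nonneg fun n _ => trialCoupling_nonneg (h n) _ _)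
    have := hAB f ω h₁ h₂
    split_ifs <;> first | tauto | norm_num
  rw [sum_ugfCoeff_eq_sum, ugfCoeff_eq_sum, bernoulliSumProb_eq_sum N l u p k,
    sum_prod_trialWeight_mul l u p, sum_prod_trialWeight_mul l u p]
  constructor
  · apply hmono
    omega
  · apply hmono
    omega
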